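/- arXiv:2509.08508 — 2 statements merged into one kernel-verified Lean document; each statement's English description precedes it below -/
import Mathlib

section
/- Let V be a finite-dimensional vector space over a field of characteristic zero and u ⊆ End(V) a Lie subalgebra (under the commutator bracket) all of whose elements are nilpotent endomorphisms. Then the exponential map exp : u → GL(V), exp(x) = Σ_{k≥0} x^k/k!, is injective, and its image {exp(x) : x ∈ u} is a subgroup of GL(V). -/
/-- The exponential `exp x = Σ_{k ≥ 0} x^k / k!` of an endomorphism of a finite-dimensional
vector space; for a nilpotent `x` the series terminates in degree `≤ finrank K V`, so the
truncated sum below is the full exponential. -/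
noncomputable def expEnd {K V : Type*} [Field K] [AddCommGroup V] [Module K V]
    [FiniteDimensional K V] (x : Module.End K V) : Module.End K V :=
  ∑ k ∈ Finset.range (Module.finrank K V + 1), ((k.factorial : K)⁻¹) • x ^ k

namespace BCHaux
open IsNilpotent Polynomial

lemma exp_expand {A : Type*} [Ring A] [Algebra ℚ A] {w : A} (h : IsNilpotent w) :
    ∃ s, Commute w s ∧ exp w = 1 + w + w * w * s := by
  obtain ⟨k, hk⟩ := h
  have hk' : w ^ (k + 2) = 0 := by rw [pow_add, hk, zero_mul]
  refine ⟨∑ i ∈ Finset.range k, ((i+2).factorial : ℚ)⁻¹ • w ^ i, ?_, ?_⟩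
  · exact Commute.sum_right _ _ _ fun i _ => ((Commute.refl w).pow_right i).smul_right _
  · rw [exp_eq_sum hk', Finset.sum_range_succ', Finset.sum_range_succ', Finset.mul_sum]
    simp only [Nat.factorial, mul_smul_comm]
    have : ∀ i, w * w * w ^ i = w ^ (i + 1 + 1) := fun i => by
      rw [_root_.pow_succ', _root_.pow_succ', mul_assoc]
    simp only [this]
    simp
    abel

/-- `exp w - 1` is a unit times `w`. -/
lemma exp_sub_one {A : Type*} [Ring A] [Algebra ℚ A] {w : A} (h : IsNilpotent w) :
    ∃ v, IsUnit v ∧ exp w - 1 = v * w := by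
  obtain ⟨s, hs, he⟩ := exp_expand h
  refine ⟨1 + w * s, ?_, ?_⟩
  · exact (hs.isNilpotent_mul_right h).isUnit_one_add
  · rw [he, add_mul, mul_assoc w s w, ← hs.eq, mul_assoc]; simp [add_assoc]

lemma exists_log_comm {A : Type*} [CommRing A] [Algebra ℚ A] {p : A} (h : IsNilpotent p) (k : ℕ) :
    ∃ z, p ∣ z ∧ p ^ (k+1) ∣ exp z - (1 + p) := by
  have nil : ∀ z, p ∣ z → IsNilpotent z := by
    rintro _ ⟨c, rfl⟩
    exact (Commute.all p c).isNilpotent_mul_right h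
  induction k with
  | zero => exact ⟨0, dvd_zero _, by simp⟩
  | succ k ih =>
    obtain ⟨z, hz, r, hr⟩ := ih
    have hd : p ∣ -(p ^ (k+1) * r) := by
      rw [dvd_neg]; exact Dvd.dvd.mul_right (dvd_pow_self p (by omega)) r
    refine ⟨z + -(p^(k+1) * r), dvd_add hz hd, ?_⟩
    rw [exp_add_of_commute (Commute.all _ _) (nil _ hz) (nil _ hd)]
    obtain ⟨s, -, hs⟩ := exp_expand (nil _ hd)
    rw [hs, show exp z = 1 + p + p ^ (k+1) * r by rw [← hr]; ring]
    refine ⟨-r - p ^ k * r * r + (1 + p + p ^ (k+1) * r) * p ^ k * r * r * s, ?_⟩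
    ring

lemma exists_log {A : Type*} [Ring A] [Algebra ℚ A] {p : A} (h : IsNilpotent p) :
    ∃ z, IsNilpotent z ∧ exp z = 1 + p := by
  letI := Algebra.adjoinCommRingOfComm ℚ (s := {p}) (by simp)
  let S := Algebra.adjoin ℚ {p}
  let q : S := ⟨p, Algebra.subset_adjoin rfl⟩
  obtain ⟨k, hk⟩ := h
  have hq : q ^ (k+1) = 0 := by
    apply Subtype.ext
    simp [q, _root_.pow_succ, hk]
  obtain ⟨z, hz, he⟩ := exists_log_comm ⟨_, hq⟩ k
  rw [hq, zero_dvd_iff, sub_eq_zero] at he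
  have hzn : IsNilpotent z := by
    obtain ⟨c, rfl⟩ := hz
    exact (Commute.all q c).isNilpotent_mul_right ⟨_, hq⟩
  refine ⟨S.val z, hzn.map S.val, ?_⟩
  rw [← map_exp hzn S.val, he]
  simp [q]

/-- commutator operator -/
noncomputable def adC {A : Type*} [Ring A] [Algebra ℚ A] (x : A) : Module.End ℚ A :=
  LinearMap.mulLeft ℚ x + -LinearMap.mulRight ℚ x

lemma adC_apply {A : Type*} [Ring A] [Algebra ℚ A] (x y : A) : adC x y = x * y - y * x := by
  simp [adC, sub_eq_add_neg]

section
variable {A : Type*} [Ring A] [Algebra ℚ A]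

lemma comm_lr (x : A) :
    Commute (LinearMap.mulLeft ℚ x : Module.End ℚ A) (-LinearMap.mulRight ℚ x : Module.End ℚ A) := by
  rw [commute_iff_eq]
  ext a
  simp [mul_assoc]

lemma nil_left {x : A} (h : IsNilpotent x) : IsNilpotent (LinearMap.mulLeft ℚ x) := by
  obtain ⟨k, hk⟩ := h
  exact ⟨k, by rw [LinearMap.pow_mulLeft, hk]; simp⟩

lemma nil_right {x : A} (h : IsNilpotent x) : IsNilpotent (LinearMap.mulRight ℚ x) := by
  obtain ⟨k, hk⟩ := h
  exact ⟨k, by rw [LinearMap.pow_mulRight, hk]; simp⟩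

lemma adC_nil {x : A} (h : IsNilpotent x) : IsNilpotent (adC x) := 
  (comm_lr x).isNilpotent_add (nil_left h) (nil_right h).neg

lemma exp_left {x : A} (h : IsNilpotent x) (y : A) :
    exp (LinearMap.mulLeft ℚ x) y = exp x * y := by
  obtain ⟨k, hk⟩ := h
  rw [exp_eq_sum hk, exp_eq_sum (k := k) (by rw [LinearMap.pow_mulLeft, hk]; simp)]
  simp [LinearMap.pow_mulLeft, Finset.sum_mul]

lemma exp_right {x : A} (h : IsNilpotent x) (y : A) :
    exp (LinearMap.mulRight ℚ x) y = y * exp x := by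
  obtain ⟨k, hk⟩ := h
  rw [exp_eq_sum hk, exp_eq_sum (k := k) (by rw [LinearMap.pow_mulRight, hk]; simp)]
  simp [LinearMap.pow_mulRight, Finset.mul_sum]

lemma exp_adC {x : A} (h : IsNilpotent x) (y : A) :
    exp (adC x) y = exp x * y * exp (-x) := by
  have : -LinearMap.mulRight ℚ x = LinearMap.mulRight ℚ (-x) := by ext; simp
  rw [adC, exp_add_of_commute (comm_lr x) (nil_left h)
    (nil_right h).neg, this, Module.End.mul_apply, exp_right h.neg, exp_left h, mul_assoc]

lemma exp_inj {x y : A} (hx : IsNilpotent x) (hy : IsNilpotent y) (h : exp x = exp y) : x = y := by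
  have h1 : exp (adC x) y = y := by
    rw [exp_adC hx, h]
    have hc : Commute (exp y) y := by
      rw [exp]; exact Commute.sum_left _ _ _ fun i _ => ((Commute.refl y).pow_left i).smul_left _
    rw [hc.eq, mul_assoc, ← h, exp_mul_exp_neg_self hx, mul_one]
  obtain ⟨v, hv, he⟩ := exp_sub_one (adC_nil hx)
  have h2 : adC x y = 0 := by
    have := congrArg (fun f => f y) he
    obtain ⟨v, rfl⟩ := hv
    simp [h1] at this
    have h3 := congrArg (v⁻¹).val this.symm
    rw [← Module.End.mul_apply] at h3
    simpa using h3
  have hc : Commute x y := by rw [adC_apply, sub_eq_zero] at h2; exact h2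
  have hn : IsNilpotent (x + -y) := hc.neg_right.isNilpotent_add hx hy.neg
  have h4 : exp (x + -y) = 1 := by
    rw [exp_add_of_commute hc.neg_right hx hy.neg, h, exp_mul_exp_neg_self hy]
  obtain ⟨v, hv, he⟩ := exp_sub_one hn
  rw [h4, sub_self] at he
  rw [eq_comm, hv.mul_right_eq_zero] at he
  rwa [← sub_eq_add_neg, sub_eq_zero] at he

lemma adC_pow_D (D : Module.End ℚ A) (hD : ∀ a b, D (a * b) = D a * b + a * D b) (z : A) (k : ℕ) :
    (adC (LinearMap.mulLeft ℚ z) ^ (k+1)) D = - LinearMap.mulLeft ℚ ((adC z ^ k) (D z)) := by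
  induction k with
  | zero => ext a; simp [adC_apply, hD]
  | succ k ih =>
    rw [pow_succ', Module.End.mul_apply, ih, pow_succ' (adC z), Module.End.mul_apply]
    ext a; simp [adC_apply, sub_mul, mul_assoc]; abel

lemma deriv_exp (D : Module.End ℚ A) (hD : ∀ a b, D (a * b) = D a * b + a * D b) {z : A}
    (hz : IsNilpotent z) {N : ℕ} (hN : adC (LinearMap.mulLeft ℚ z) ^ (N+1) = 0) :
    D (exp z) = (∑ k ∈ Finset.range N, ((k+1).factorial : ℚ)⁻¹ • (adC z ^ k) (D z)) * exp z := by
  have h1 := congrArg (fun f => f (exp z)) (exp_adC (nil_left hz) D)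
  have hneg : -LinearMap.mulLeft ℚ z = LinearMap.mulLeft ℚ (-z) := by ext; simp
  have hD1 : D 1 = 0 := by simpa using hD 1 1
  simp only [Module.End.mul_apply] at h1
  rw [hneg, exp_left hz.neg, exp_neg_mul_exp_self hz, hD1, map_zero, exp_eq_sum hN,
    Finset.sum_range_succ'] at h1
  simp only [LinearMap.add_apply, LinearMap.sum_apply, LinearMap.smul_apply, adC_pow_D D hD] at h1
  simp only [LinearMap.neg_apply, LinearMap.mulLeft_apply, smul_neg, Finset.sum_neg_distrib] at h1
  simp only [pow_zero, Nat.factorial_zero, Nat.cast_one, inv_one, one_smul, Module.End.one_apply]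
    at h1
  rw [neg_add_eq_zero] at h1
  rw [← h1, Finset.sum_mul]
  simp

lemma inv_mem (M : Submodule ℚ A) (T : Module.End ℚ A) (hT : IsNilpotent T)
    (hM : ∀ a ∈ M, T a ∈ M) (N : ℕ) (v : A)
    (h : ∑ k ∈ Finset.range (N+1), ((k+1).factorial : ℚ)⁻¹ • (T ^ k) v ∈ M) : v ∈ M := by
  obtain ⟨n, hn⟩ := hT
  have hMp : ∀ i, ∀ a ∈ M, (T ^ i) a ∈ M := by
    intro i
    induction i with
    | zero => simp
    | succ i ih => intro a ha; rw [pow_succ', Module.End.mul_apply]; exact hM _ (ih a ha)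
  have key : ∀ m, m ≤ n → ∀ i, n - m ≤ i → (T ^ i) v ∈ M := by
    intro m
    induction m with
    | zero =>
      intro _ i hi
      rw [pow_eq_zero_of_le (by omega) hn]; simp
    | succ m ih =>
      intro hm i hi
      have h1 := hMp i _ h
      rw [Finset.sum_range_succ', map_add, map_sum] at h1
      have h2 : ∑ k ∈ Finset.range N, (T ^ i) (((k+1+1).factorial : ℚ)⁻¹ • (T ^ (k+1)) v) ∈ M := by
        refine M.sum_mem fun k _ => ?_
        rw [map_smul, ← Module.End.mul_apply, ← pow_add]
        exact M.smul_mem _ (ih (by omega) _ (by omega))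
      have h3 := (M.add_mem_iff_right h2).1 h1
      simpa using h3
  simpa using key n le_rfl 0 (by omega)

section filt
variable (B : ℕ → Submodule ℚ A) (hmul : ∀ i j a b, a ∈ B i → b ∈ B j → a * b ∈ B (i+j))
  (hanti : ∀ i, B (i+1) ≤ B i) (N : ℕ) (hN : B N = ⊥)
include hmul
lemma pow_mem_filt {a : A} (ha : a ∈ B 1) (k : ℕ) : a ^ (k+1) ∈ B (k+1) := by
  induction k with
  | zero => simpa
  | succ k ih => rw [_root_.pow_succ]; exact hmul _ _ _ _ ih ha

include hanti
include hN in
lemma nil_of_filt {a : A} (ha : a ∈ B 1) : IsNilpotent a := by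
  refine ⟨N + 1, ?_⟩
  have := hanti N (pow_mem_filt B hmul ha N)
  rwa [hN] at this

include hN in
lemma exp_sub_one_filt {a : A} (ha : a ∈ B 1) : exp a - 1 ∈ B 1 := by
  obtain ⟨k, hk⟩ := nil_of_filt B hmul hanti N hN ha
  have hk : a ^ (k+1) = 0 := by rw [_root_.pow_succ, hk, zero_mul]
  rw [exp_eq_sum hk, Finset.sum_range_succ']
  simp only [pow_zero, Nat.factorial_zero, Nat.cast_one, inv_one, one_smul, add_sub_cancel_right]
  refine Submodule.sum_mem _ fun i _ => Submodule.smul_mem _ _ ?_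
  have h1 := pow_mem_filt B hmul ha i
  exact antitone_nat_of_succ_le hanti (by omega : 1 ≤ i+1) h1

include hN in
lemma exp_mul_filt {a b : A} (ha : a ∈ B 1) (hb : b ∈ B 1) :
    IsNilpotent (exp a * exp b - 1) := by
  have h1 := exp_sub_one_filt B hmul hanti N hN ha
  have h2 := exp_sub_one_filt B hmul hanti N hN hb
  apply nil_of_filt B hmul hanti N hN
  have : exp a * exp b - 1 = (exp a - 1) * (exp b - 1) + (exp a - 1) + (exp b - 1) := by noncomm_ring
  rw [this]
  exact Submodule.add_mem _ (Submodule.add_mem _ (hanti 1 (hmul 1 1 _ _ h1 h2)) h1) h2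

end filt

/-- polynomials whose first `n` coefficients are in `u` -/
noncomputable def polyLT (u : Submodule ℚ A) (n : ℕ) : Submodule ℚ A[X] where
  carrier := {p | ∀ i < n, p.coeff i ∈ u}
  add_mem' ha hb i hi := by rw [coeff_add]; exact u.add_mem (ha i hi) (hb i hi)
  zero_mem' i _ := by simp
  smul_mem' c p hp i hi := by rw [coeff_smul]; exact u.smul_mem c (hp i hi)

/-- polynomials with all coefficients in `u` -/
noncomputable def polyAll (u : Submodule ℚ A) : Submodule ℚ A[X] where
  carrier := {p | ∀ i, p.coeff i ∈ u}
  add_mem' ha hb i := by rw [coeff_add]; exact u.add_mem (ha i) (hb i)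
  zero_mem' i := by simp
  smul_mem' c p hp i := by rw [coeff_smul]; exact u.smul_mem c (hp i)

lemma polyLT_lie (u : Submodule ℚ A) (hu : ∀ x ∈ u, ∀ y ∈ u, x * y - y * x ∈ u) (n : ℕ)
    {p q : A[X]} (hp : p ∈ polyLT u n) (hq : q ∈ polyLT u n) : p * q - q * p ∈ polyLT u n := by
  intro i hi
  rw [coeff_sub, coeff_mul, coeff_mul, ← Finset.Nat.sum_antidiagonal_swap, ← Finset.sum_sub_distrib]
  refine u.sum_mem fun ij hij => ?_
  rw [Finset.HasAntidiagonal.mem_antidiagonal] at hij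
  exact hu _ (hp _ (by simp; omega)) _ (hq _ (by simp; omega))

theorem exp_mul_mem (u : Submodule ℚ A) (hu : ∀ x ∈ u, ∀ y ∈ u, x * y - y * x ∈ u)
    (B : ℕ → Submodule ℚ A) (hmul : ∀ i j a b, a ∈ B i → b ∈ B j → a * b ∈ B (i+j))
    (hanti : ∀ i, B (i+1) ≤ B i) (N : ℕ) (hN : B N = ⊥) (huB : u ≤ B 1)
    {x y : A} (hx : x ∈ u) (hy : y ∈ u) : ∃ z ∈ u, exp z = exp x * exp y := by
  have hxn := nil_of_filt B hmul hanti N hN (huB hx)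
  have hyn := nil_of_filt B hmul hanti N hN (huB hy)
  have hmul' : ∀ i j a b, a ∈ polyAll (B i) → b ∈ polyAll (B j) → a * b ∈ polyAll (B (i+j)) := by
    intro i j a b ha hb k
    rw [coeff_mul]
    exact Submodule.sum_mem _ fun ij _ => hmul _ _ _ _ (ha _) (hb _)
  have hanti' : ∀ i, polyAll (B (i+1)) ≤ polyAll (B i) := fun i p hp k => hanti i (hp k)
  have hN' : polyAll (B N) = ⊥ := by
    rw [eq_bot_iff]
    intro p hp
    rw [Submodule.mem_bot]
    ext i
    simpa [hN] using hp i
  have hX : C x ∈ polyAll (B 1) := by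
    intro i
    rw [coeff_C]; split_ifs
    · exact huB hx
    · simp
  have hY : monomial 1 y ∈ polyAll (B 1) := by
    intro i
    rw [coeff_monomial]; split_ifs
    · exact huB hy
    · simp
  have hXn := nil_of_filt _ hmul' hanti' N hN' hX
  have hYn := nil_of_filt _ hmul' hanti' N hN' hY
  obtain ⟨z, hzn, hz⟩ := exists_log (exp_mul_filt _ hmul' hanti' N hN' hX hY)
  rw [add_sub_cancel] at hz
  -- the initial value
  have h0 : z.coeff 0 = x := by
    have h1 := congrArg constantCoeff hz
    rw [map_mul, map_exp hzn, map_exp hXn, map_exp hYn] at h1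
    simp [coeff_monomial] at h1
    exact exp_inj (hzn.map constantCoeff) hxn h1
  -- derivative
  let D : Module.End ℚ A[X] := (derivative (R := A)).restrictScalars ℚ
  have hDdef : ∀ p, D p = derivative p := fun _ => rfl
  have hD : ∀ a b, D (a * b) = D a * b + a * D b := fun a b => derivative_mul
  have hDY : D (exp (monomial 1 y)) = C y * exp (monomial 1 y) := by
    obtain ⟨n, hn⟩ := adC_nil (nil_left hYn)
    have hn : adC (LinearMap.mulLeft ℚ (monomial 1 y : A[X])) ^ (n+1+1) = 0 :=
      pow_eq_zero_of_le (by omega) hn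
    rw [deriv_exp D hD hYn hn, Finset.sum_range_succ', Finset.sum_eq_zero]
    · simp [hDdef]
    · intro k _
      have : adC (monomial 1 y : A[X]) (D (monomial 1 y)) = 0 := by
        rw [adC_apply, hDdef]
        simp [derivative_monomial, monomial_mul_monomial, ← monomial_zero_left]
      rw [_root_.pow_succ, Module.End.mul_apply, this]; simp
  have hDX : D (exp (C x)) = 0 := by
    rw [← map_exp hxn C, hDdef, derivative_C]
  have hc : exp (adC x) y ∈ u := by
    have hp : ∀ i, (adC x ^ i) y ∈ u := by
      intro i
      induction i with
      | zero => simpa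
      | succ i ih => rw [pow_succ', Module.End.mul_apply, adC_apply]; exact hu _ hx _ ih
    rw [exp]
    simp only [LinearMap.sum_apply, LinearMap.smul_apply]
    exact u.sum_mem fun i _ => u.smul_mem _ (hp i)
  obtain ⟨n, hn⟩ := adC_nil (nil_left hzn)
  have hn : adC (LinearMap.mulLeft ℚ z) ^ (n+1+1) = 0 := pow_eq_zero_of_le (by omega) hn
  have hode : ∑ k ∈ Finset.range (n+1), ((k+1).factorial : ℚ)⁻¹ • (adC z ^ k) (D z)
      = C (exp (adC x) y) := by
    apply (isUnit_exp hzn).mul_right_cancel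
    rw [← deriv_exp D hD hzn hn, hz, hD, hDX, hDY, zero_mul, zero_add, exp_adC hxn, C_mul, C_mul,
      map_exp hxn C, map_exp hxn.neg C, C_neg, ← mul_assoc, ← mul_assoc,
      mul_assoc (_ * _) (exp (-C x)), exp_neg_mul_exp_self hXn, mul_one]
  have hcoef : ∀ m, z ∈ polyLT u (m+1) := by
    intro m
    induction m with
    | zero =>
      intro i hi
      obtain rfl : i = 0 := by omega
      rw [h0]; exact hx
    | succ m ih =>
      have hd : D z ∈ polyLT u (m+1) := by
        refine inv_mem _ (adC z) (adC_nil hzn) (fun a ha => ?_) n _ ?_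
        · rw [adC_apply]; exact polyLT_lie u hu _ ih ha
        · rw [hode]
          intro i _
          rw [coeff_C]; split_ifs
          · exact hc
          · simp
      intro i hi
      rcases i with _ | i
      · rw [h0]; exact hx
      · have h1 := hd i (by omega)
        rw [hDdef, coeff_derivative] at h1
        have h2 := u.smul_mem ((i+1 : ℚ)⁻¹) h1
        have h3 : (z.coeff (i+1) * ((i:A)+1)) = ((i:ℚ)+1) • z.coeff (i+1) := by
          rw [Algebra.smul_def, Algebra.commutes]; simp
        rw [h3, smul_smul, inv_mul_cancel₀ (by positivity), one_smul] at h2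
        exact h2
  let ev : A[X] →+* A := eval₂RingHom' (RingHom.id A) 1 (fun a => Commute.one_right _)
  have hev : ∀ p, ev p = eval 1 p := fun _ => rfl
  refine ⟨ev z, ?_, ?_⟩
  · rw [hev, eval_eq_sum]
    exact u.sum_mem fun i _ => by simpa using hcoef i i (by omega)
  · rw [← map_exp hzn ev, hz, map_mul, map_exp hXn ev, map_exp hYn ev]
    simp [hev]
end
end BCHaux

attribute [local instance 100] LieRing.ofAssociativeRing

/-- For a Lie subalgebra `u ⊆ End V` consisting of nilpotent endomorphisms, the exponential
map is injective on `u` and its image `{exp x : x ∈ u}` is a subgroup of `GL(V)`. -/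
theorem exp_injective_image_subgroup {K V : Type*} [Field K] [CharZero K]
    [AddCommGroup V] [Module K V] [FiniteDimensional K V]
    (u : LieSubalgebra K (Module.End K V))
    (hu : ∀ x ∈ u, IsNilpotent x) :
    (∀ x ∈ u, ∀ y ∈ u, expEnd x = expEnd y → x = y) ∧
    (∀ x ∈ u, IsUnit (expEnd x)) ∧
    (∃ H : Subgroup (Module.End K V)ˣ,
      ∀ g : (Module.End K V)ˣ, g ∈ H ↔ ∃ x ∈ u, (g : Module.End K V) = expEnd x) := by
  letI : Algebra ℚ (Module.End K V) := Algebra.compHom _ (algebraMap ℚ K)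
  have hsmul : ∀ (q : ℚ) (f : Module.End K V), q • f = (q : K) • f := fun q f => rfl
  have hexp : ∀ x : Module.End K V, IsNilpotent x → expEnd x = IsNilpotent.exp x := by
    intro x hx
    have h : x ^ (Module.finrank K V + 1) = 0 := by
      obtain ⟨m, hm⟩ := hx
      have h0 : x ^ Module.finrank K V = 0 := by
        ext v
        apply Module.End.ker_pow_le_ker_pow_finrank x m
        simp [hm]
      rw [pow_succ, h0, zero_mul]
    rw [IsNilpotent.exp_eq_sum h, expEnd]
    refine Finset.sum_congr rfl fun k _ => ?_
    rw [hsmul]; simp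
  have hnil : LieModule.IsNilpotent u V := by
    rw [LieModule.isNilpotent_iff_forall' (R := K)]
    rintro ⟨x, hx⟩
    exact hu x hx
  obtain ⟨N, hN⟩ := (LieModule.isNilpotent_iff K u V).1 hnil
  let F : ℕ → LieSubmodule K u V := fun k => LieModule.lowerCentralSeries K u V k
  let B : ℕ → Submodule ℚ (Module.End K V) := fun k =>
    { carrier := {a | ∀ j, ∀ v ∈ F j, a v ∈ F (j + k)}
      add_mem' := fun ha hb j v hv => (F (j+k)).add_mem (ha j v hv) (hb j v hv)
      zero_mem' := fun j v _ => (F (j+k)).zero_mem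
      smul_mem' := fun c a ha j v hv => (F (j+k)).smul_mem (c : K) (ha j v hv) }
  let u' : Submodule ℚ (Module.End K V) :=
    { carrier := u
      add_mem' := fun ha hb => u.add_mem ha hb
      zero_mem' := u.zero_mem
      smul_mem' := fun c a ha => u.smul_mem (c : K) ha }
  have hprod : ∀ x ∈ u, ∀ y ∈ u, ∃ z ∈ u, IsNilpotent.exp z = IsNilpotent.exp x * IsNilpotent.exp y := by
    intro x hx y hy
    refine BCHaux.exp_mul_mem u' (fun x hx y hy => u.lie_mem hx hy) B ?_ ?_ N ?_ ?_ hx hy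
    · intro i j a b ha hb k v hv
      have := ha _ _ (hb _ _ hv)
      rw [add_assoc, add_comm j i] at this
      exact this
    · intro i a ha j v hv
      exact LieModule.antitone_lowerCentralSeries K u V (by omega : j + i ≤ j + (i+1)) (ha j v hv)
    · rw [eq_bot_iff]
      intro a ha
      rw [Submodule.mem_bot]
      ext v
      have h := ha 0 v (by simp [F])
      simp only [F, zero_add, hN] at h
      simpa using h
    · intro a ha j v hv
      have : ⁅(⟨a, ha⟩ : u), v⁆ ∈ F (j+1) := by
        simp only [F, LieModule.lowerCentralSeries_succ]
        exact LieSubmodule.lie_mem_lie (LieSubmodule.mem_top _) hv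
      exact this
  refine ⟨fun x hx y hy h => ?_, fun x hx => ?_, ?_⟩
  · rw [hexp x (hu x hx), hexp y (hu y hy)] at h
    exact BCHaux.exp_inj (hu x hx) (hu y hy) h
  · rw [hexp x (hu x hx)]
    exact IsNilpotent.isUnit_exp (hu x hx)
  · refine ⟨{ carrier := {g | ∃ x ∈ u, (g : Module.End K V) = expEnd x}
              mul_mem' := ?_
              one_mem' := ?_
              inv_mem' := ?_ }, fun g => Iff.rfl⟩
    · rintro g h ⟨x, hx, hg⟩ ⟨y, hy, hh⟩
      obtain ⟨z, hz, he⟩ := hprod x hx y hy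
      refine ⟨z, hz, ?_⟩
      rw [hexp z (hu z hz), he, Units.val_mul, hg, hh, hexp x (hu x hx), hexp y (hu y hy)]
    · refine ⟨0, u.zero_mem, ?_⟩
      rw [hexp 0 (hu 0 u.zero_mem)]; simp
    · rintro g ⟨x, hx, hg⟩
      refine ⟨-x, u.neg_mem hx, ?_⟩
      rw [hexp _ (hu _ (u.neg_mem hx))]
      rw [hexp _ (hu _ hx)] at hg
      apply Units.inv_eq_of_mul_eq_one_right
      rw [hg]
      exact IsNilpotent.exp_mul_exp_neg_self (hu x hx)
end

section
/- Let V be a finite-dimensional vector space over a field of characteristic zero and u ⊆ End(V) a Lie subalgebra all of whose elements are nilpotent endomorphisms. Suppose u = u₁ ⊕ u₂ is a direct sum of vector subspaces with u₁ and u₂ themselves Lie subalgebras. Then the product map (x, y) ↦ exp(x)·exp(y) is a bijection from u₁ × u₂ onto exp(u) = {exp(z) : z ∈ u}. -/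
attribute [local instance 100] LieRing.ofAssociativeRing

/-- A multiplicative descending filtration that vanishes in degree `M + 1`. -/
structure NFilt (K B : Type*) [Field K] [Ring B] [Algebra K B] (M : ℕ) where
  J : ℕ → Submodule K B
  mul : ∀ {i j a b}, a ∈ J i → b ∈ J j → a * b ∈ J (i + j)
  anti : ∀ i, J (i + 1) ≤ J i
  one : 1 ∈ J 0
  bot : ∀ a ∈ J (M + 1), a = 0

/-- truncated exponential -/
noncomputable def tex (K : Type*) {B : Type*} [Field K] [Ring B] [Algebra K B] (M : ℕ) (z : B) : B :=
  ∑ k ∈ Finset.range (M + 1), ((k.factorial : K)⁻¹) • z ^ k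

/-- iterated commutator -/
def adI {B : Type*} [Ring B] (z w : B) : ℕ → B
  | 0 => w
  | k + 1 => z * adI z w k - adI z w k * z

section
open Finset
set_option linter.unusedSectionVars false
variable {K B : Type*} [Field K] [CharZero K] [Ring B] [Algebra K B] {M : ℕ}

lemma NFilt.le (F : NFilt K B M) {i j : ℕ} (h : i ≤ j) : F.J j ≤ F.J i :=
  antitone_nat_of_succ_le F.anti h

lemma NFilt.zero_of (F : NFilt K B M) {i : ℕ} (h : M + 1 ≤ i) {a : B} (ha : a ∈ F.J i) : a = 0 :=
  F.bot a (F.le h ha)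

lemma NFilt.pow (F : NFilt K B M) {z : B} (hz : z ∈ F.J 1) (n : ℕ) : z ^ n ∈ F.J n := by
  induction n with
  | zero => simpa using F.one
  | succ n ih => rw [pow_succ]; exact F.mul ih hz

lemma NFilt.adI_mem (F : NFilt K B M) {z w : B} (hz : z ∈ F.J 1) (hw : w ∈ F.J 1) (n : ℕ) :
    adI z w n ∈ F.J (n + 1) := by
  induction n with
  | zero => simpa [adI] using hw
  | succ n ih =>
    refine sub_mem ?_ (F.mul ih hz)
    rw [add_comm (n + 1) 1]
    exact F.mul hz ih

lemma NFilt.pow_sub (F : NFilt K B M) {z z' : B} {j : ℕ} (hz : z ∈ F.J 1) (hz' : z' ∈ F.J 1)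
    (h : z - z' ∈ F.J j) (n : ℕ) : z ^ (n + 1) - z' ^ (n + 1) ∈ F.J (j + n) := by
  induction n with
  | zero => simpa using h
  | succ n ih =>
    have e : z ^ (n + 1 + 1) - z' ^ (n + 1 + 1)
      = z ^ (n + 1) * (z - z') + (z ^ (n + 1) - z' ^ (n + 1)) * z' := by
      rw [pow_succ z (n + 1), pow_succ z' (n + 1)]; noncomm_ring
    rw [e]
    refine add_mem ?_ (by rw [← add_assoc]; exact F.mul ih hz')
    have := F.mul (F.pow hz (n + 1)) h
    rwa [add_comm] at this

lemma NFilt.tex_sub (F : NFilt K B (M + 1)) {z z' : B} {j : ℕ} (hz : z ∈ F.J 1) (hz' : z' ∈ F.J 1)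
    (h : z - z' ∈ F.J j) : tex K (M + 1) z - tex K (M + 1) z' - (z - z') ∈ F.J (j + 1) := by
  have e : tex K (M + 1) z - tex K (M + 1) z' - (z - z') =
      ∑ k ∈ range M, (((k + 2).factorial : K)⁻¹) • (z ^ (k + 2) - z' ^ (k + 2)) := by
    unfold tex
    rw [sum_range_succ', sum_range_succ', sum_range_succ' _ (M + 1), sum_range_succ' _ M]
    simp only [smul_sub, sum_sub_distrib]
    simp
    abel
  rw [e]
  refine Submodule.sum_mem _ fun k _ => Submodule.smul_mem _ _ ?_
  have := F.pow_sub hz hz' h (k + 1)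
  exact F.le (by omega) this

lemma NFilt.tex_inj (F : NFilt K B (M + 1)) {z z' : B} (hz : z ∈ F.J 1) (hz' : z' ∈ F.J 1)
    (h : tex K (M + 1) z = tex K (M + 1) z') : z = z' := by
  have : ∀ j, z - z' ∈ F.J j := by
    intro j
    induction j with
    | zero => exact F.le (Nat.zero_le 1) (sub_mem hz hz')
    | succ j ih =>
      have := F.tex_sub hz hz' ih
      rw [h, sub_self, zero_sub] at this
      simpa using neg_mem this
  exact sub_eq_zero.1 (F.bot _ (this _))

lemma tex_zero : tex K M (0 : B) = 1 := by
  unfold tex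
  rw [sum_range_succ']
  simp

lemma NFilt.tex_surj (F : NFilt K B (M + 1)) {g : B} (hg : g - 1 ∈ F.J 1) :
    ∃ z ∈ F.J 1, tex K (M + 1) z = g := by
  have : ∀ j, ∃ z ∈ F.J 1, g - tex K (M + 1) z ∈ F.J (j + 1) := by
    intro j
    induction j with
    | zero => exact ⟨0, zero_mem _, by simpa [tex_zero] using hg⟩
    | succ j ih =>
      obtain ⟨z, hz, h⟩ := ih
      have hz2 : z + (g - tex K (M + 1) z) ∈ F.J 1 := add_mem hz (F.le (by omega) h)
      refine ⟨_, hz2, ?_⟩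
      have := F.tex_sub hz2 hz (j := j + 1) (by simpa using h)
      have := neg_mem this
      convert this using 1
      abel
  obtain ⟨z, hz, h⟩ := this (M + 1)
  exact ⟨z, hz, (sub_eq_zero.1 (F.bot _ h)).symm⟩

lemma NFilt.tex_mem (F : NFilt K B M) {z : B} (hz : z ∈ F.J 1) : tex K M z - 1 ∈ F.J 1 := by
  unfold tex
  rw [sum_range_succ']
  simp only [Nat.factorial_zero, Nat.cast_one, inv_one, pow_zero, one_smul, add_sub_cancel_right]
  exact Submodule.sum_mem _ fun k _ => Submodule.smul_mem _ _ (F.le (by omega) (F.pow hz _))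

lemma NFilt.mul_mem (F : NFilt K B M) {a b : B} (ha : a - 1 ∈ F.J 1) (hb : b - 1 ∈ F.J 1) :
    a * b - 1 ∈ F.J 1 := by
  have e : a * b - 1 = (a - 1) * (b - 1) + (a - 1) + (b - 1) := by noncomm_ring
  rw [e]
  exact add_mem (add_mem (F.le (by omega) (F.mul ha hb)) ha) hb

lemma NFilt.isUnit (F : NFilt K B M) {a : B} (ha : a - 1 ∈ F.J 1) : IsUnit a := by
  have : IsNilpotent (a - 1) := ⟨M + 1, F.bot _ (F.pow ha _)⟩
  simpa using this.isUnit_one_add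

lemma derivation_pow (δ : B →ₗ[K] B) (hδ : ∀ a b, δ (a * b) = δ a * b + a * δ b) (z : B) (n : ℕ) :
    δ (z ^ (n + 1)) = ∑ k ∈ range (n + 1),
      (((n + 1).choose (k + 1) : ℕ) : K) • (adI z (δ z) k * z ^ (n - k)) := by
  induction n with
  | zero => simp [adI]
  | succ n ih =>
    rw [pow_succ' z (n + 1), hδ, ih, mul_sum]
    have e1 : ∀ k ∈ range (n + 1), z * ((((n + 1).choose (k + 1) : ℕ) : K) • (adI z (δ z) k * z ^ (n - k)))
       = (((n + 1).choose (k + 1) : ℕ) : K) • (adI z (δ z) (k + 1) * z ^ (n - k)) +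
        (((n + 1).choose (k + 1) : ℕ) : K) • (adI z (δ z) k * z ^ (n + 1 - k)) := by
      intro k hk
      rw [mem_range] at hk
      rw [← smul_add, mul_smul_comm, show n + 1 - k = (n - k) + 1 by omega, pow_succ' z (n - k)]
      congr 1
      simp only [adI]
      noncomm_ring
    rw [sum_congr rfl e1, sum_add_distrib]
    have e2 : ∀ k ∈ range (n + 1 + 1), (((n + 1 + 1).choose (k + 1) : ℕ) : K) • (adI z (δ z) k * z ^ (n + 1 - k))
      = (((n + 1).choose k : ℕ) : K) • (adI z (δ z) k * z ^ (n + 1 - k)) +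
       (((n + 1).choose (k + 1) : ℕ) : K) • (adI z (δ z) k * z ^ (n + 1 - k)) := by
      intro k hk
      rw [← add_smul, Nat.choose_succ_succ (n + 1) k]
      push_cast
      rfl
    rw [sum_congr rfl e2, sum_add_distrib, sum_range_succ' _ (n + 1),
      sum_range_succ (fun k => (((n + 1).choose (k + 1) : ℕ) : K) • (adI z (δ z) k * z ^ (n + 1 - k))) (n + 1)]
    simp [adI]
    abel

/-- the operator `(exp (ad z) - 1) / ad z` applied to `w` -/
noncomputable def adT (K : Type*) {B : Type*} [Field K] [Ring B] [Algebra K B] (M : ℕ) (z w : B) : B :=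
  ∑ k ∈ range M, (((k + 1).factorial : K)⁻¹) • adI z w k

lemma NFilt.deriv_tex (F : NFilt K B M) (δ : B →ₗ[K] B)
    (hδ : ∀ a b, δ (a * b) = δ a * b + a * δ b) {z : B} (hz : z ∈ F.J 1) (hw : δ z ∈ F.J 1) :
    δ (tex K M z) = adT K M z (δ z) * tex K M z := by
  have h1 : δ 1 = 0 := by
    have := hδ 1 1
    simpa using this
  have hz0 : z ^ (M + 1) = 0 := F.bot _ (F.pow hz _)
  unfold tex adT
  set f : ℕ → ℕ → B := fun k m =>
    ((((k + 1).factorial : K)⁻¹) * ((m.factorial : K)⁻¹)) • (adI z (δ z) k * z ^ m) with hf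
  have L : δ (∑ k ∈ range (M + 1), ((k.factorial : K)⁻¹) • z ^ k)
      = ∑ n ∈ range M, ∑ k ∈ range (n + 1), f k (n - k) := by
    rw [sum_range_succ', map_add, map_sum]
    simp only [pow_zero, map_smul, h1, smul_zero, add_zero]
    refine sum_congr rfl fun n _ => ?_
    rw [derivation_pow δ hδ, smul_sum]
    refine sum_congr rfl fun k hk => ?_
    rw [mem_range] at hk
    rw [hf, smul_smul]
    congr 1
    have := Nat.choose_mul_factorial_mul_factorial (n := n + 1) (k := k + 1) (by omega)
    rw [show n + 1 - (k + 1) = n - k by omega] at this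
    have a1 : ((n + 1).factorial : K) ≠ 0 := by exact_mod_cast Nat.factorial_ne_zero _
    have a2 : ((k + 1).factorial : K) ≠ 0 := by exact_mod_cast Nat.factorial_ne_zero _
    have a3 : ((n - k).factorial : K) ≠ 0 := by exact_mod_cast Nat.factorial_ne_zero _
    have this' : (((n + 1).choose (k + 1) : ℕ) : K) * ((k + 1).factorial : K) * ((n - k).factorial : K)
      = ((n + 1).factorial : K) := by exact_mod_cast this
    field_simp
    linear_combination this'
  rw [L, sum_range_diag_flip, sum_mul]
  refine sum_congr rfl fun k hk => ?_
  rw [mem_range] at hk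
  rw [mul_sum]
  have : ∀ m ∈ range (M + 1), (((k + 1).factorial : K)⁻¹ • adI z (δ z) k) * ((m.factorial : K)⁻¹ • z ^ m)
      = f k m := by
    intro m _
    rw [smul_mul_smul_comm]
  rw [sum_congr rfl this]
  refine sum_subset (fun m hm => by simp at hm ⊢; omega) fun m _ hm => ?_
  simp at hm
  have : adI z (δ z) k * z ^ m = 0 := F.zero_of (i := (k + 1) + m) (by omega)
    (F.mul (F.adI_mem hz hw k) (F.pow hz m))
  simp [hf, this]
end

section
open Polynomial Finset
set_option linter.unusedSectionVars false
variable {K A : Type*} [Field K] [CharZero K] [Ring A] [Algebra K A] {M : ℕ}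

/-- coefficientwise filtration on polynomials -/
def NFilt.poly (F : NFilt K A M) : NFilt K A[X] M where
  J i :=
    { carrier := {P | ∀ n, P.coeff n ∈ F.J i}
      add_mem' := fun {P Q} hP hQ n => by
        rw [coeff_add]; exact add_mem (hP n) (hQ n)
      zero_mem' := fun n => by rw [coeff_zero]; exact zero_mem _
      smul_mem' := fun c P hP n => by
        rw [coeff_smul]; exact Submodule.smul_mem _ _ (hP n) }
  mul := fun {i j P Q} hP hQ n => by
    rw [coeff_mul]
    exact Submodule.sum_mem _ fun p _ => F.mul (hP _) (hQ _)
  anti := fun i P hP n => F.anti i (hP n)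
  one := fun n => by
    rw [coeff_one]
    split_ifs
    · exact F.one
    · exact zero_mem _
  bot := fun P hP => by
    ext n
    simpa using F.bot _ (hP n)

lemma map_tex {B C : Type*} [Ring B] [Algebra K B] [Ring C] [Algebra K C] (φ : B →+* C)
    (hφ : ∀ (c : K) b, φ (c • b) = c • φ b) (z : B) : φ (tex K M z) = tex K M (φ z) := by
  simp [tex, hφ]

/-- the derivation sending P to its derivative plus the commutator of y and P -/
noncomputable def pder (K : Type*) {A : Type*} [Field K] [Ring A] [Algebra K A] (y : A) :
    A[X] →ₗ[K] A[X] where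
  toFun P := derivative P + (C y * P - P * C y)
  map_add' P Q := by
    rw [derivative_add]; noncomm_ring
  map_smul' c P := by
    rw [derivative_smul]
    simp [smul_add, smul_sub]

lemma pder_mul (y : A) (P Q : A[X]) :
    pder K y (P * Q) = pder K y P * Q + P * pder K y Q := by
  simp only [pder, LinearMap.coe_mk, AddHom.coe_mk, derivative_mul]
  noncomm_ring

lemma pder_zero (P : A[X]) : pder K 0 P = derivative P := by
  simp [pder]

lemma NFilt.der_line (F : NFilt K A (M + 1)) {x : A} (hx : x ∈ F.J 1) :
    derivative (tex K (M + 1) (C x * X)) = C x * tex K (M + 1) (C x * X) := by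
  have hz : C x * X ∈ F.poly.J 1 := fun n => by
    rw [coeff_C_mul_X]
    split_ifs
    · exact hx
    · exact zero_mem _
  have hw : pder K 0 (C x * X) = C x := by rw [pder_zero]; simp
  have hw' : C x ∈ F.poly.J 1 := fun n => by
    rw [coeff_C]
    split_ifs
    · exact hx
    · exact zero_mem _
  have := F.poly.deriv_tex (pder K (0 : A)) (pder_mul 0) hz (by rw [hw]; exact hw')
  rw [hw, pder_zero] at this
  rw [this]
  congr 1
  unfold adT
  rw [sum_range_succ']
  have h0 : ∀ k, adI (C x * X) (C x) (k + 1) = 0 := by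
    intro k
    induction k with
    | zero =>
      simp only [adI]
      rw [mul_assoc, X_mul, ← mul_assoc, sub_self]
    | succ k ih => rw [adI, ih]; simp
  simp [h0]
  rfl

/-- Baker-Campbell-Hausdorff, qualitative form. -/
lemma NFilt.bch (F : NFilt K A (M + 1)) (L D : Submodule K A) (hL : L ≤ F.J 1) (hDL : D ≤ L)
    (hD : ∀ a ∈ L, ∀ b ∈ L, a * b - b * a ∈ D) {x y : A} (hx : x ∈ L) (hy : y ∈ L) :
    ∃ z ∈ L, z - (x + y) ∈ D ∧
      tex K (M + 1) x * tex K (M + 1) y = tex K (M + 1) z := by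
  have line : ∀ x ∈ F.J 1, C x * X ∈ F.poly.J 1 := fun x hx n => by
    rw [coeff_C_mul_X]
    split_ifs
    · exact hx
    · exact zero_mem _
  have const : ∀ x ∈ F.J 1, C x ∈ F.poly.J 1 := fun x hx n => by
    rw [coeff_C]
    split_ifs
    · exact hx
    · exact zero_mem _
  set G : A[X] := tex K (M + 1) (C x * X) * tex K (M + 1) (C y * X) with hG
  have hGm : G - 1 ∈ F.poly.J 1 :=
    F.poly.mul_mem (F.poly.tex_mem (line x (hL hx))) (F.poly.tex_mem (line y (hL hy)))
  obtain ⟨Z, hZ, hZG⟩ := F.poly.tex_surj hGm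
  -- constant coefficient
  have hZ0 : Z.coeff 0 = 0 := by
    refine F.tex_inj (hZ 0) (zero_mem _) ?_
    have h := congrArg (Polynomial.constantCoeff (R := A)) hZG
    rw [hG, map_mul, map_tex, map_tex, map_tex] at h
    · simpa [tex_zero] using h
    all_goals intro c b; simp
  -- the differential equation
  have hcomm : Commute (C y) (tex K (M + 1) (C y * X)) := by
    unfold tex
    refine Commute.sum_right _ _ _ fun k _ => Commute.smul_right (Commute.pow_right ?_ _) _
    exact (Commute.refl _).mul_right (commute_X _).symm
  have hδG : pder K y G = C (x + y) * G := by
    simp only [pder, LinearMap.coe_mk, AddHom.coe_mk]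
    rw [hG, derivative_mul, F.der_line (hL hx), F.der_line (hL hy), C_add]
    rw [hcomm.eq]
    noncomm_ring
  have hw : pder K y Z ∈ F.poly.J 1 := by
    refine add_mem (fun n => ?_) (sub_mem ?_ ?_)
    · rw [coeff_derivative]
      have := Submodule.smul_mem (F.J 1) ((n : K) + 1) (hZ (n + 1))
      convert this using 1
      rw [Algebra.smul_def, Algebra.commutes]
      simp
    · exact F.poly.le (by omega) (F.poly.mul (const y (hL hy)) hZ)
    · exact F.poly.le (by omega) (F.poly.mul hZ (const y (hL hy)))
  have hT : adT K (M + 1) Z (pder K y Z) = C (x + y) := by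
    have := F.poly.deriv_tex (pder K y) (pder_mul y) hZ hw
    rw [hZG, hδG] at this
    exact ((F.poly.isUnit hGm).mul_left_injective this).symm
  have hrec : derivative Z = C (x + y) - (C y * Z - Z * C y) -
      ∑ k ∈ range M, (((k + 2).factorial : K)⁻¹) • adI Z (pder K y Z) (k + 1) := by
    rw [← hT]
    unfold adT
    rw [sum_range_succ']
    have e0 : adI Z (pder K y Z) 0 = derivative Z + (C y * Z - Z * C y) := rfl
    rw [e0]
    simp only [zero_add, Nat.factorial_one, Nat.cast_one, inv_one, one_smul]
    abel
  -- brackets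
  have br : ∀ n (P Q : A[X]), (∀ i ≤ n, P.coeff i ∈ L) → (∀ i ≤ n, Q.coeff i ∈ L) →
      ∀ i ≤ n, (P * Q - Q * P).coeff i ∈ D := by
    intro n P Q hP hQ i hi
    rw [coeff_sub, coeff_mul, coeff_mul, ← Finset.Nat.sum_antidiagonal_swap, ← sum_sub_distrib]
    refine Submodule.sum_mem _ fun p hp => ?_
    rw [HasAntidiagonal.mem_antidiagonal] at hp
    exact hD _ (hP _ (by simp; omega)) _ (hQ _ (by simp; omega))
  have br' : ∀ n (Q : A[X]), (∀ i ≤ n, Z.coeff i ∈ L) → (∀ i < n, Q.coeff i ∈ L) →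
      ∀ i ≤ n, (Z * Q - Q * Z).coeff i ∈ D := by
    intro n Q hP hQ i hi
    rw [coeff_sub, coeff_mul, coeff_mul, ← Finset.Nat.sum_antidiagonal_swap, ← sum_sub_distrib]
    refine Submodule.sum_mem _ fun p hp => ?_
    rw [HasAntidiagonal.mem_antidiagonal] at hp
    simp only [Prod.fst_swap, Prod.snd_swap]
    rcases Nat.eq_zero_or_pos p.2 with h0 | h0
    · rw [h0, hZ0]; simp
    · exact hD _ (hP _ (by omega)) _ (hQ _ (by omega))
  have cC : ∀ a ∈ L, ∀ i, (C a).coeff i ∈ L := fun a ha i => by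
    rw [coeff_C]
    split_ifs
    · exact ha
    · exact zero_mem _
  have step : ∀ n, (∀ i ≤ n, Z.coeff i ∈ L) →
      Z.coeff (n + 1) - (if n = 0 then x + y else 0) ∈ D := by
    intro n ih
    have cder : ∀ i, (derivative Z).coeff i = ((i : K) + 1) • Z.coeff (i + 1) := by
      intro i
      rw [coeff_derivative, Algebra.smul_def, Algebra.commutes]
      simp
    have hyZ : ∀ i ≤ n, (C y * Z - Z * C y).coeff i ∈ D :=
      br n _ _ (fun i _ => cC y hy i) ih
    have hwL : ∀ i < n, (pder K y Z).coeff i ∈ L := by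
      intro i hi
      simp only [pder, LinearMap.coe_mk, AddHom.coe_mk]
      rw [coeff_add, cder]
      exact add_mem (Submodule.smul_mem _ _ (ih _ (by omega))) (hDL (hyZ i (by omega)))
    have hadI : ∀ k, ∀ i ≤ n, (adI Z (pder K y Z) (k + 1)).coeff i ∈ D := by
      intro k
      induction k with
      | zero => exact br' n _ ih hwL
      | succ k ihk => exact br' n _ ih fun i hi => hDL (ihk i hi.le)
    have h := congrArg (fun P => coeff P n) hrec
    simp only [cder, coeff_sub, finsetSum_coeff, coeff_smul] at h
    have h' : ((n : K) + 1) • Z.coeff (n + 1) - (if n = 0 then x + y else 0) ∈ D := by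
      rw [h, coeff_C, ← coeff_sub]
      have ab : ∀ p q r : A, p - q - r - p = -(q + r) := fun p q r => by abel
      rw [ab]
      exact neg_mem (add_mem (hyZ n le_rfl) (Submodule.sum_mem _ fun k _ =>
        Submodule.smul_mem _ _ (hadI k n le_rfl)))
    rcases Nat.eq_zero_or_pos n with h0 | h0
    · subst h0; simpa using h'
    · rw [if_neg h0.ne', sub_zero] at h' ⊢
      have hne : ((n : K) + 1) ≠ 0 := by exact_mod_cast Nat.succ_ne_zero n
      have := Submodule.smul_mem D ((n : K) + 1)⁻¹ h'
      rwa [smul_smul, inv_mul_cancel₀ hne, one_smul] at this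
  have hZL : ∀ n, ∀ i ≤ n, Z.coeff i ∈ L := by
    intro n
    induction n with
    | zero => intro i hi; rw [Nat.le_zero.1 hi, hZ0]; exact zero_mem _
    | succ n ih =>
      intro i hi
      rcases Nat.lt_or_ge i (n + 1) with h | h
      · exact ih i (by omega)
      · obtain rfl : i = n + 1 := le_antisymm hi h
        have := add_mem (hDL (step n ih)) (show (if n = 0 then x + y else 0) ∈ L by
          split_ifs
          · exact add_mem hx hy
          · exact zero_mem _)
        simpa using this
  -- evaluation at `1`
  let ev : A[X] →+* A := eval₂RingHom' (RingHom.id A) 1 (fun a => Commute.one_right _)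
  have hev : ∀ P : A[X], ev P = ∑ i ∈ range (P.natDegree + 1), P.coeff i := by
    intro P
    change eval₂ (RingHom.id A) 1 P = _
    rw [eval₂_eq_sum_range]
    simp
  have hevs : ∀ (c : K) (P : A[X]), ev (c • P) = c • ev P := by
    intro c P
    change eval₂ (RingHom.id A) 1 (c • P) = c • eval₂ (RingHom.id A) 1 P
    rw [← algebraMap_smul A c P, ← algebraMap_smul A c (eval₂ _ _ P), eval₂_smul]
    simp
  have hevl : ∀ a : A, ev (C a * X) = a := by
    intro a
    change eval₂ (RingHom.id A) 1 (C a * X) = a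
    simp
  have hmain : ev Z - (x + y) ∈ D := by
    have e : ev Z = ∑ i ∈ range (Z.natDegree + 2), Z.coeff i := by
      rw [hev, sum_range_succ _ (Z.natDegree + 1), coeff_eq_zero_of_natDegree_lt (by omega), add_zero]
    have e2 : x + y = ∑ i ∈ range (Z.natDegree + 1), (if i = 0 then x + y else 0) := by
      simp
    rw [e, sum_range_succ', hZ0, add_zero, e2, ← sum_sub_distrib]
    exact Submodule.sum_mem _ fun i _ => step i (hZL i)
  refine ⟨ev Z, ?_, hmain, ?_⟩
  · have := add_mem (hDL hmain) (add_mem hx hy)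
    simpa using this
  · rw [← map_tex ev hevs, hZG, hG, map_mul, map_tex ev hevs, map_tex ev hevs, hevl, hevl]

lemma NFilt.tex_mul_neg (F : NFilt K A (M + 1)) {x : A} (hx : x ∈ F.J 1) :
    tex K (M + 1) x * tex K (M + 1) (-x) = 1 := by
  obtain ⟨z, -, hz, h⟩ := F.bch (K ∙ x) ⊥ (by simpa using hx) bot_le (by
    intro a ha b hb
    obtain ⟨s, rfl⟩ := Submodule.mem_span_singleton.1 ha
    obtain ⟨t, rfl⟩ := Submodule.mem_span_singleton.1 hb
    simp [smul_smul, mul_comm]) (x := x) (y := -x)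
    (Submodule.mem_span_singleton_self x) (neg_mem (Submodule.mem_span_singleton_self x))
  have : z = 0 := by simpa using hz
  rw [h, this, tex_zero]

lemma NFilt.tex_neg_mul (F : NFilt K A (M + 1)) {x : A} (hx : x ∈ F.J 1) :
    tex K (M + 1) (-x) * tex K (M + 1) x = 1 := by
  simpa using F.tex_mul_neg (neg_mem hx)

/-- The factorisation statement for a filtered algebra. -/
lemma NFilt.factor (F : NFilt K A (M + 1)) (u u₁ u₂ : Submodule K A) (hu : u ≤ F.J 1)
    (bu : ∀ a ∈ u, ∀ b ∈ u, a * b - b * a ∈ u)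
    (b1 : ∀ a ∈ u₁, ∀ b ∈ u₁, a * b - b * a ∈ u₁)
    (b2 : ∀ a ∈ u₂, ∀ b ∈ u₂, a * b - b * a ∈ u₂)
    (h : u₁ ⊔ u₂ = u) {z : A} (hz : z ∈ u) :
    ∃ x ∈ u₁, ∃ y ∈ u₂, tex K (M + 1) x * tex K (M + 1) y = tex K (M + 1) z := by
  have h1 : u₁ ≤ u := h ▸ le_sup_left
  have h2 : u₂ ≤ u := h ▸ le_sup_right
  have key : ∀ k, ∃ w ∈ u₁ ⊔ (u ⊓ F.J (k + 1)), ∃ y ∈ u₂,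
      tex K (M + 1) w * tex K (M + 1) y = tex K (M + 1) z := by
    intro k
    induction k with
    | zero =>
      exact ⟨z, le_sup_right (a := u₁) ⟨hz, hu hz⟩, 0, zero_mem _, by rw [tex_zero, mul_one]⟩
    | succ k ih =>
      obtain ⟨w, hw, y, hy, e⟩ := ih
      obtain ⟨x, hx, c, hc, rfl⟩ := Submodule.mem_sup.1 hw
      obtain ⟨x', hx', y', hy', hc'⟩ := Submodule.mem_sup.1 (show c ∈ u₁ ⊔ u₂ from h ▸ hc.1)
      have hLu : u₁ ⊔ (u ⊓ F.J (k + 1)) ≤ u := sup_le h1 inf_le_left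
      have hy'L : y' ∈ u₁ ⊔ (u ⊓ F.J (k + 1)) := by
        have : y' = -x' + c := by rw [← hc']; abel
        rw [this]
        exact Submodule.add_mem_sup (neg_mem hx') hc
      obtain ⟨w', -, hw', e'⟩ := F.bch (u₁ ⊔ (u ⊓ F.J (k + 1))) (u₁ ⊔ (u ⊓ F.J (k + 1 + 1)))
        (hLu.trans hu) (sup_le_sup_left (inf_le_inf_left _ (F.anti _)) _) (by
          intro a ha b hb
          obtain ⟨a1, ha1, a2, ha2, rfl⟩ := Submodule.mem_sup.1 ha
          obtain ⟨b1', hb1, b2', hb2, rfl⟩ := Submodule.mem_sup.1 hb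
          have e : (a1 + a2) * (b1' + b2') - (b1' + b2') * (a1 + a2) = (a1 * b1' - b1' * a1) +
            ((a1 * b2' - b2' * a1) + (a2 * (b1' + b2') - (b1' + b2') * a2)) := by noncomm_ring
          rw [e]
          have hb := hLu hb
          have q : ∀ p ∈ u, ∀ r ∈ u ⊓ F.J (k + 1), p * r - r * p ∈ u ⊓ F.J (k + 1 + 1) := by
            intro p hp r hr
            refine ⟨bu _ hp _ hr.1, sub_mem ?_ (F.mul hr.2 (hu hp))⟩
            rw [add_comm (k + 1) 1]
            exact F.mul (hu hp) hr.2
          refine Submodule.add_mem_sup (b1 _ ha1 _ hb1) (add_mem (q _ (h1 ha1) _ hb2) ?_)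
          rw [← neg_sub]
          exact neg_mem (q _ hb _ ha2)) hw (neg_mem hy'L)
      obtain ⟨y'', hy'', -, e''⟩ := F.bch u₂ u₂ (h2.trans hu) le_rfl b2 hy' hy
      refine ⟨w', ?_, y'', hy'', ?_⟩
      · have e3 : w' = (x + x') + (w' - (x + c + -y')) := by rw [← hc']; abel
        rw [e3]
        exact add_mem (Submodule.mem_sup_left (add_mem hx hx')) hw'
      · rw [← e', ← e'', ← e, mul_assoc, ← mul_assoc _ (tex K (M + 1) y'),
          F.tex_neg_mul (hu (h2 hy')), one_mul]
  obtain ⟨w, hw, y, hy, e⟩ := key (M + 1)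
  refine ⟨w, ?_, y, hy, e⟩
  obtain ⟨x, hx, c, hc, rfl⟩ := Submodule.mem_sup.1 hw
  rw [F.bot c hc.2, add_zero]
  exact hx

lemma NFilt.uniq (F : NFilt K A (M + 1)) (u₁ u₂ : Submodule K A)
    (hu1 : u₁ ≤ F.J 1) (hu2 : u₂ ≤ F.J 1)
    (b1 : ∀ a ∈ u₁, ∀ b ∈ u₁, a * b - b * a ∈ u₁)
    (b2 : ∀ a ∈ u₂, ∀ b ∈ u₂, a * b - b * a ∈ u₂)
    (h : u₁ ⊓ u₂ = ⊥) {x x' y y' : A} (hx : x ∈ u₁) (hx' : x' ∈ u₁) (hy : y ∈ u₂) (hy' : y' ∈ u₂)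
    (e : tex K (M + 1) x * tex K (M + 1) y = tex K (M + 1) x' * tex K (M + 1) y') :
    x = x' ∧ y = y' := by
  obtain ⟨a, ha, -, ea⟩ := F.bch u₁ u₁ hu1 le_rfl b1 (neg_mem hx') hx
  obtain ⟨b, hb, -, eb⟩ := F.bch u₂ u₂ hu2 le_rfl b2 hy' (neg_mem hy)
  have hab : tex K (M + 1) a = tex K (M + 1) b := by
    rw [← ea, ← eb]
    calc tex K (M + 1) (-x') * tex K (M + 1) x
        = tex K (M + 1) (-x') * (tex K (M + 1) x * tex K (M + 1) y) * tex K (M + 1) (-y) := by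
          rw [mul_assoc, mul_assoc, F.tex_mul_neg (hu2 hy), mul_one]
      _ = (tex K (M + 1) (-x') * tex K (M + 1) x') * tex K (M + 1) y' * tex K (M + 1) (-y) := by
          rw [e, mul_assoc, mul_assoc, mul_assoc, mul_assoc]
      _ = _ := by rw [F.tex_neg_mul (hu1 hx'), one_mul]
  have hab' : a = b := F.tex_inj (hu1 ha) (hu2 hb) hab
  have ha0 : a = 0 := by
    have : a ∈ u₁ ⊓ u₂ := ⟨ha, hab' ▸ hb⟩
    rw [h] at this
    simpa using this
  have exx : tex K (M + 1) x = tex K (M + 1) x' := by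
    rw [ha0, tex_zero] at ea
    calc tex K (M + 1) x = (tex K (M + 1) x' * tex K (M + 1) (-x')) * tex K (M + 1) x := by
          rw [F.tex_mul_neg (hu1 hx'), one_mul]
      _ = tex K (M + 1) x' := by rw [mul_assoc, ea, mul_one]
  refine ⟨F.tex_inj (hu1 hx) (hu1 hx') exx, F.tex_inj (hu2 hy) (hu2 hy') ?_⟩
  rw [exx] at e
  exact (F.isUnit (F.tex_mem (hu1 hx'))).mul_right_injective e

end

/-- The filtration of `End V` induced by the lower central series of `V` as a `u`-module. -/
def lcsFilt {K V : Type*} [Field K] [AddCommGroup V] [Module K V]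
    (u : LieSubalgebra K (Module.End K V)) (M : ℕ)
    (hM : LieModule.lowerCentralSeries K u V (M + 1) = ⊥) : NFilt K (Module.End K V) M where
  J k :=
    { carrier := {a | ∀ i, ∀ v ∈ LieModule.lowerCentralSeries K u V i,
        a v ∈ LieModule.lowerCentralSeries K u V (i + k)}
      add_mem' := fun {a b} ha hb i v hv => by
        rw [LinearMap.add_apply]; exact add_mem (ha i v hv) (hb i v hv)
      zero_mem' := fun i v hv => by rw [LinearMap.zero_apply]; exact zero_mem _
      smul_mem' := fun c a ha i v hv => by
        rw [LinearMap.smul_apply]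
        exact (LieModule.lowerCentralSeries K u V (i + k)).smul_mem c (ha i v hv) }
  mul := fun {k l a b} ha hb i v hv => by
    have := ha _ _ (hb i v hv)
    rw [Module.End.mul_apply, add_comm k l, ← add_assoc]
    exact this
  anti := fun k a ha i v hv =>
    LieModule.antitone_lowerCentralSeries K u V (by omega) (ha i v hv)
  one := fun i v hv => hv
  bot := fun a ha => by
    ext v
    have := ha 0 v (by simp)
    rw [zero_add, hM] at this
    simpa using this

lemma expEnd_eq_tex {K V : Type*} [Field K] [AddCommGroup V] [Module K V]
    [FiniteDimensional K V] {x : Module.End K V} (hx : IsNilpotent x) {M : ℕ}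
    (hM : Module.finrank K V ≤ M) : expEnd x = tex K M x := by
  have h0 : x ^ Module.finrank K V = 0 := by
    obtain ⟨m, hm⟩ := hx
    have := Module.End.ker_pow_le_ker_pow_finrank x m
    rw [hm, LinearMap.ker_zero, top_le_iff, LinearMap.ker_eq_top] at this
    exact this
  unfold expEnd tex
  refine Finset.sum_subset (fun k hk => by simp at hk ⊢; omega) fun k _ hk => ?_
  simp at hk
  rw [pow_eq_zero_of_le (by omega) h0, smul_zero]

/-- If a Lie subalgebra `u ⊆ End V` of nilpotent endomorphisms decomposes as a direct sum
`u = u₁ ⊕ u₂` of Lie subalgebras, then `(x, y) ↦ exp x * exp y` is a bijection from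
`u₁ × u₂` onto `exp u = {exp z : z ∈ u}`. -/
theorem exp_product_bijection {K V : Type*} [Field K] [CharZero K]
    [AddCommGroup V] [Module K V] [FiniteDimensional K V]
    (u u₁ u₂ : LieSubalgebra K (Module.End K V))
    (hu : ∀ x ∈ u, IsNilpotent x)
    (h₁ : u₁ ≤ u) (h₂ : u₂ ≤ u)
    (hsup : u₁.toSubmodule ⊔ u₂.toSubmodule = u.toSubmodule)
    (hdisj : u₁.toSubmodule ⊓ u₂.toSubmodule = ⊥) :
    (∀ x ∈ u₁, ∀ y ∈ u₂, ∃ z ∈ u, expEnd x * expEnd y = expEnd z) ∧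
    (∀ z ∈ u, ∃ x ∈ u₁, ∃ y ∈ u₂, expEnd x * expEnd y = expEnd z) ∧
    (∀ x ∈ u₁, ∀ x' ∈ u₁, ∀ y ∈ u₂, ∀ y' ∈ u₂,
      expEnd x * expEnd y = expEnd x' * expEnd y' → x = x' ∧ y = y') := by
  have hnil : LieModule.IsNilpotent u V := by
    rw [LieModule.isNilpotent_iff_forall' (R := K)]
    rintro ⟨x, hx⟩
    exact hu x hx
  obtain ⟨m, hm⟩ := (LieModule.isNilpotent_iff K u V).1 hnil
  set M := m + Module.finrank K V with hMdef
  have hM : LieModule.lowerCentralSeries K u V (M + 1 + 1) = ⊥ := by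
    rw [eq_bot_iff, ← hm]
    exact LieModule.antitone_lowerCentralSeries K u V (by omega)
  let F := lcsFilt u (M + 1) hM
  have hF : u.toSubmodule ≤ F.J 1 := by
    intro x hx i v hv
    rw [LieModule.lowerCentralSeries_succ]
    exact LieSubmodule.lie_mem_lie (LieSubmodule.mem_top (⟨x, hx⟩ : u)) hv
  have hE : ∀ x ∈ u, expEnd x = tex K (M + 1) x := fun x hx => expEnd_eq_tex (hu x hx) (by omega)
  have br : ∀ L : LieSubalgebra K (Module.End K V), ∀ a ∈ L.toSubmodule, ∀ b ∈ L.toSubmodule,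
      a * b - b * a ∈ L.toSubmodule := fun L a ha b hb => L.lie_mem ha hb
  refine ⟨?_, ?_, ?_⟩
  · intro x hx y hy
    obtain ⟨z, hz, -, e⟩ := F.bch u.toSubmodule u.toSubmodule hF le_rfl (br u) (h₁ hx) (h₂ hy)
    exact ⟨z, hz, by rw [hE x (h₁ hx), hE y (h₂ hy), hE z hz, e]⟩
  · intro z hz
    obtain ⟨x, hx, y, hy, e⟩ := F.factor u.toSubmodule u₁.toSubmodule u₂.toSubmodule hF
      (br u) (br u₁) (br u₂) hsup hz
    exact ⟨x, hx, y, hy, by rw [hE x (h₁ hx), hE y (h₂ hy), hE z hz, e]⟩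
  · intro x hx x' hx' y hy y' hy' e
    rw [hE x (h₁ hx), hE y (h₂ hy), hE x' (h₁ hx'), hE y' (h₂ hy')] at e
    exact F.uniq u₁.toSubmodule u₂.toSubmodule (le_trans h₁ hF) (le_trans h₂ hF)
      (br u₁) (br u₂) hdisj hx hx' hy hy' e
end
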